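/- Let π be a policy with π(a|s) > 0 for all (s,a) and let π' be its NPG update with respect to Q̂ and stepsize β. Then for any probability distribution ν on S: (1/β) Σ_s ν(s) log Z(s) ≤ V^{π'}(ν) − V^π(ν) + (3/(1−γ)) ‖Q̂ − Q^π‖∞. -/

import Mathlib

noncomputable def supNorm {I : Type*} [Fintype I] [Nonempty I] (f : I → ℝ) : ℝ :=
  Finset.univ.sup' Finset.univ_nonempty (fun i => |f i|)

noncomputable def matNorm {I : Type*} [Fintype I] [Nonempty I] (M : Matrix I I ℝ) : ℝ :=
  supNorm (fun i => ∑ j, |M i j|)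

/-- `π` is a policy: for each state `s`, `π s` is a probability distribution on actions. -/
def IsPolicy {S A : Type*} [Fintype A] (π : S → A → ℝ) : Prop :=
  (∀ s a, 0 ≤ π s a) ∧ ∀ s, ∑ a, π s a = 1

/-- A row-stochastic matrix. -/
def IsStochastic {S : Type*} [Fintype S] (P : Matrix S S ℝ) : Prop :=
  (∀ s s', 0 ≤ P s s') ∧ ∀ s, ∑ s', P s s' = 1

/-- The state-action transition matrix `P_π((s,a),(s',a')) = P_a(s,s') π(a'|s')`. -/
def Psa {S A : Type*} (P : A → Matrix S S ℝ) (π : S → A → ℝ) :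
    Matrix (S × A) (S × A) ℝ :=
  Matrix.of fun p q => P p.2 p.1 q.1 * π q.1 q.2

/-- The truncated policy `π_ρ̄(a|s) = min(ρ̄ π_b(a|s), π(a|s)) / Σ_{a'} min(ρ̄ π_b(a'|s), π(a'|s))`. -/
noncomputable def truncPolicy {S A : Type*} [Fintype A] (πb π : S → A → ℝ) (ρ : ℝ) :
    S → A → ℝ :=
  fun s a => min (ρ * πb s a) (π s a) / ∑ a', min (ρ * πb s a') (π s a')

/-- The diagonal matrix with `D_π((s,a),(s,a)) = Σ_{a'} min(ρ̄ π_b(a'|s), π(a'|s))`. -/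
noncomputable def truncDiag {S A : Type*} [Fintype A] [DecidableEq S] [DecidableEq A]
    (πb π : S → A → ℝ) (ρ : ℝ) : Matrix (S × A) (S × A) ℝ :=
  Matrix.diagonal (fun p => ∑ a', min (ρ * πb p.1 a') (π p.1 a'))

/-- The NPG update of policy `π` with respect to `Q̂` and stepsize `β`. -/
noncomputable def npg {S A : Type*} [Fintype A] (π : S → A → ℝ) (β : ℝ)
    (Qh : S × A → ℝ) : S → A → ℝ :=
  fun s a => π s a * Real.exp (β * Qh (s, a)) / ∑ a', π s a' * Real.exp (β * Qh (s, a'))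

/-- The induced state transition matrix `P̃_π(s,s') = Σ_a π(a|s) P_a(s,s')`. -/
noncomputable def PtildeGen {S A : Type*} [Fintype A] (P : A → Matrix S S ℝ)
    (π : S → A → ℝ) : Matrix S S ℝ :=
  Matrix.of fun s s' => ∑ a, π s a * P a s s'

/-- The discounted state visitation distribution
`d_μ^π(s) = (1−γ) Σ_{j=0}^∞ γ^j (μᵀ P̃_π^j)(s)`. -/
noncomputable def dvisit {S A : Type*} [Fintype S] [Fintype A] [DecidableEq S]
    (P : A → Matrix S S ℝ) (π : S → A → ℝ) (γ : ℝ) (μ : S → ℝ) : S → ℝ :=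
  fun s => (1 - γ) * ∑' j : ℕ, γ ^ j * Matrix.vecMul μ (PtildeGen P π ^ j) s

/-- KL divergence `Σ_a p(a) log(p(a)/q(a))` between distributions on actions. -/
noncomputable def klA {A : Type*} [Fintype A] (p q : A → ℝ) : ℝ :=
  ∑ a, p a * Real.log (p a / q a)

theorem abs_le_supNorm {I : Type*} [Fintype I] [Nonempty I] (f : I → ℝ) (i : I) :
    |f i| ≤ supNorm f :=
  Finset.le_sup' (fun i => |f i|) (Finset.mem_univ i)

theorem sum_mul_le_log_sum_mul_exp {A : Type*} [Fintype A] {p : A → ℝ}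
    (hp : ∀ a, 0 ≤ p a) (hp1 : ∑ a, p a = 1) (x : A → ℝ) :
    ∑ a, p a * x a ≤ Real.log (∑ a, p a * Real.exp (x a)) := by
  have h : Real.exp (∑ a, p a * x a) ≤ ∑ a, p a * Real.exp (x a) := by
    simpa using convexOn_exp.map_sum_le (t := Finset.univ) (fun a _ => hp a) hp1
      (fun a _ => Set.mem_univ (x a))
  exact (Real.le_log_iff_exp_le ((Real.exp_pos _).trans_le h)).2 h

section NPG

variable {S A : Type*} [Fintype A] [Nonempty A] {π : S → A → ℝ}

theorem npg_partition_pos (hpos : ∀ s a, 0 < π s a) (β : ℝ) (Qh : S × A → ℝ) (s : S) :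
    0 < ∑ a, π s a * Real.exp (β * Qh (s, a)) :=
  Finset.sum_pos (fun a _ => mul_pos (hpos s a) (Real.exp_pos _)) Finset.univ_nonempty

theorem isPolicy_npg (hpos : ∀ s a, 0 < π s a) (β : ℝ) (Qh : S × A → ℝ) :
    IsPolicy (npg π β Qh) := by
  refine ⟨fun s a => ?_, fun s => ?_⟩
  · exact div_nonneg (mul_pos (hpos s a) (Real.exp_pos _)).le (npg_partition_pos hpos β Qh s).le
  · simp only [npg, ← Finset.sum_div]
    exact div_self (npg_partition_pos hpos β Qh s).ne'

/-- The log-partition function is at most the mean of the exponent under the tilted policy. -/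
theorem log_partition_le_npg_sum (hπ : IsPolicy π) (hpos : ∀ s a, 0 < π s a) (β : ℝ)
    (Qh : S × A → ℝ) (s : S) :
    Real.log (∑ a, π s a * Real.exp (β * Qh (s, a))) ≤
      ∑ a, npg π β Qh s a * (β * Qh (s, a)) := by
  have hπ' := isPolicy_npg hpos β Qh
  have h := sum_mul_le_log_sum_mul_exp (hπ'.1 s) (hπ'.2 s) (fun a => -(β * Qh (s, a)))
  have hW : ∑ a, npg π β Qh s a * Real.exp (-(β * Qh (s, a))) =
      (∑ a, π s a * Real.exp (β * Qh (s, a)))⁻¹ := by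
    simp only [npg, div_mul_eq_mul_div, mul_assoc, ← Real.exp_add, add_neg_cancel,
      Real.exp_zero, mul_one, ← Finset.sum_div, hπ.2 s, one_div]
  rw [hW, Real.log_inv] at h
  simp only [mul_neg, Finset.sum_neg_distrib] at h
  linarith

theorem log_sum_mul_exp_mul_sub (hpos : ∀ s a, 0 < π s a) (β : ℝ) (Qh : S × A → ℝ)
    (s : S) (v : ℝ) :
    Real.log (∑ a, π s a * Real.exp (β * (Qh (s, a) - v))) =
      Real.log (∑ a, π s a * Real.exp (β * Qh (s, a))) - β * v := by
  simp only [mul_sub, Real.exp_sub, ← mul_div_assoc, ← Finset.sum_div]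
  rw [Real.log_div (npg_partition_pos hpos β Qh s).ne' (Real.exp_ne_zero _), Real.log_exp]

end NPG

theorem bellman_apply {S A : Type*} [Fintype S] [Fintype A] {P : A → Matrix S S ℝ}
    {R : S × A → ℝ} {γ : ℝ} {π : S → A → ℝ} {Q : S × A → ℝ}
    (hQ : Q = R + γ • (Psa P π).mulVec Q) (s : S) (a : A) :
    Q (s, a) = R (s, a) + γ * ∑ s', P a s s' * ∑ a', π s' a' * Q (s', a') := by
  have h := congrFun hQ (s, a)
  simpa [Psa, Matrix.mulVec, dotProduct, Fintype.sum_prod_type, Finset.mul_sum, mul_assoc]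
    using h

theorem le_sum_mul_of_forall_le {I : Type*} [Fintype I] {p f : I → ℝ} {c : ℝ}
    (hp : ∀ i, 0 ≤ p i) (hp1 : ∑ i, p i = 1) (hf : ∀ i, c ≤ f i) :
    c ≤ ∑ i, p i * f i := by
  calc c = ∑ i, p i * c := by rw [← Finset.sum_mul, hp1, one_mul]
    _ ≤ ∑ i, p i * f i := Finset.sum_le_sum fun i _ => mul_le_mul_of_nonneg_left (hf i) (hp i)

/-- If `f` dominates `g` plus `γ` times an average of `f`, and `g ≥ -c`, then `f` dominates `g`
up to `γ c / (1 - γ)`. -/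
theorem sub_le_of_discounted_recursion {S A : Type*} [Fintype S] [Fintype A] [Nonempty S]
    {P : A → Matrix S S ℝ} (hP : ∀ a, IsStochastic (P a)) {π : S → A → ℝ} (hπ : IsPolicy π)
    {γ : ℝ} (hγ0 : 0 < γ) (hγ1 : γ < 1) {f g : S → ℝ} {c : ℝ} (hg : ∀ s, -c ≤ g s)
    (h : ∀ s, g s + γ * ∑ a, π s a * ∑ s', P a s s' * f s' ≤ f s) (s : S) :
    g s - γ * c / (1 - γ) ≤ f s := by
  obtain ⟨s₀, hs₀⟩ := Finite.exists_min f
  have havg (s : S) : f s₀ ≤ ∑ a, π s a * ∑ s', P a s s' * f s' :=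
    le_sum_mul_of_forall_le (hπ.1 s) (hπ.2 s) fun a =>
      le_sum_mul_of_forall_le ((hP a).1 s) ((hP a).2 s) hs₀
  have hstep (s : S) : g s + γ * f s₀ ≤ f s :=
    le_trans (add_le_add_right (mul_le_mul_of_nonneg_left (havg s) hγ0.le) _) (h s)
  have hmin : -c / (1 - γ) ≤ f s₀ := by
    rw [div_le_iff₀ (by linarith)]
    linarith [hstep s₀, hg s₀]
  have := mul_le_mul_of_nonneg_left hmin hγ0.le
  rw [mul_div_assoc', mul_neg, neg_div] at this
  linarith [hstep s]

/-- For the NPG update `π'` of `π` with respect to `Q̂` and stepsize `β`,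
and any distribution `ν` on states:
`(1/β) Σ_s ν(s) log Z(s) ≤ V^{π'}(ν) − V^π(ν) + (3/(1−γ)) ‖Q̂ − Q^π‖_∞`. -/
theorem npg_log_partition_upper_bound
    {S A : Type*} [Fintype S] [Fintype A] [Nonempty S] [Nonempty A]
    (P : A → Matrix S S ℝ) (hP : ∀ a, IsStochastic (P a))
    (R : S × A → ℝ) (hR : ∀ x, 0 ≤ R x ∧ R x ≤ 1)
    (γ : ℝ) (hγ0 : 0 < γ) (hγ1 : γ < 1)
    (π : S → A → ℝ) (hπ : IsPolicy π) (hπpos : ∀ s a, 0 < π s a)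
    (β : ℝ) (hβ : 0 < β) (Qh : S × A → ℝ)
    (Qpi : S × A → ℝ) (hQpi : Qpi = R + γ • (Psa P π).mulVec Qpi)
    (Qpi' : S × A → ℝ) (hQpi' : Qpi' = R + γ • (Psa P (npg π β Qh)).mulVec Qpi')
    (ν : S → ℝ) (hν0 : ∀ s, 0 ≤ ν s) (hν1 : ∑ s, ν s = 1) :
    (1 / β) * (∑ s, ν s * Real.log (∑ a, π s a *
        Real.exp (β * (Qh (s, a) - ∑ a', π s a' * Qpi (s, a'))))) ≤
      (∑ s, ν s * (∑ a, npg π β Qh s a * Qpi' (s, a)))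
        - (∑ s, ν s * (∑ a, π s a * Qpi (s, a)))
        + (3 / (1 - γ)) * supNorm (Qh - Qpi) := by
  set ε := supNorm (Qh - Qpi)
  have hQ (x : S × A) : |Qh x - Qpi x| ≤ ε := abs_le_supNorm (Qh - Qpi) x
  have hε0 : 0 ≤ ε := (abs_nonneg _).trans (hQ (Classical.arbitrary _))
  set π' := npg π β Qh
  have hπ' : IsPolicy π' := isPolicy_npg hπpos β Qh
  set V : S → ℝ := fun s => ∑ a, π s a * Qpi (s, a) with hV
  set V' : S → ℝ := fun s => ∑ a, π' s a * Qpi' (s, a) with hV'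
  set L : S → ℝ := fun s =>
    1 / β * Real.log (∑ a, π s a * Real.exp (β * (Qh (s, a) - V s))) with hL
  have hL_lower (s : S) : -ε ≤ L s := by
    have h := sum_mul_le_log_sum_mul_exp (hπ.1 s) (hπ.2 s) (fun a => β * (Qh (s, a) - V s))
    have h₁ := mul_le_mul_of_nonneg_left h (one_div_pos.2 hβ).le
    refine le_trans ?_ h₁
    have h₂ : 1 / β * ∑ a, π s a * (β * (Qh (s, a) - V s)) =
        ∑ a, π s a * (Qh (s, a) - Qpi (s, a)) := by
      simp only [mul_left_comm _ β, ← Finset.mul_sum, mul_sub, Finset.sum_sub_distrib,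
        ← Finset.sum_mul, hπ.2 s]
      field_simp
      simp [hV]
    rw [h₂]
    exact le_sum_mul_of_forall_le (hπ.1 s) (hπ.2 s) fun a => (abs_le.1 (hQ (s, a))).1
  have hL_upper (s : S) : L s ≤ ∑ a, π' s a * Qh (s, a) - V s := by
    have h := log_partition_le_npg_sum hπ hπpos β Qh s
    simp only [mul_left_comm _ β, ← Finset.mul_sum] at h
    simp only [hL]
    rw [log_sum_mul_exp_mul_sub hπpos, one_div, inv_mul_le_iff₀ hβ]
    linarith
  have hrec (s : S) : L s - ε + γ * ∑ a, π' s a * ∑ s', P a s s' * (V' s' - V s') ≤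
      V' s - V s := by
    have h₁ := le_sum_mul_of_forall_le (hπ'.1 s) (hπ'.2 s)
      fun a => neg_le_neg (abs_le.1 (hQ (s, a))).2
    have h₂ : γ * ∑ a, π' s a * ∑ s', P a s s' * (V' s' - V s') =
        V' s - ∑ a, π' s a * Qpi (s, a) := by
      rw [hV', ← Finset.sum_sub_distrib, Finset.mul_sum]
      refine Finset.sum_congr rfl fun a _ => ?_
      rw [bellman_apply hQpi s a, bellman_apply hQpi' s a]
      simp only [mul_sub, Finset.sum_sub_distrib, hV]
      ring
    simp only [mul_neg, mul_sub, Finset.sum_neg_distrib, Finset.sum_sub_distrib] at h₁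
    rw [h₂]
    linarith [hL_upper s]
  have hpoint (s : S) : L s ≤ V' s - V s + 3 / (1 - γ) * ε := by
    have h := sub_le_of_discounted_recursion hP hπ' hγ0 hγ1 (f := fun s => V' s - V s)
      (g := fun s => L s - ε) (c := 2 * ε) (fun s => by linarith [hL_lower s]) hrec s
    have h₁ : ε + γ * (2 * ε) / (1 - γ) ≤ 3 / (1 - γ) * ε := by
      have hγ : 0 < 1 - γ := by linarith
      rw [div_mul_eq_mul_div, ← sub_nonneg]
      have : 3 * ε / (1 - γ) - (ε + γ * (2 * ε) / (1 - γ)) = (2 - γ) * ε / (1 - γ) := by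
        field_simp
        ring
      rw [this]
      exact div_nonneg (mul_nonneg (by linarith) hε0) hγ.le
    linarith
  calc 1 / β * ∑ s, ν s * Real.log (∑ a, π s a * Real.exp (β * (Qh (s, a) - V s)))
      = ∑ s, ν s * L s := by simp only [hL, Finset.mul_sum, mul_left_comm]
    _ ≤ ∑ s, ν s * (V' s - V s + 3 / (1 - γ) * ε) :=
      Finset.sum_le_sum fun s _ => mul_le_mul_of_nonneg_left (hpoint s) (hν0 s)
    _ = ∑ s, ν s * V' s - ∑ s, ν s * V s + 3 / (1 - γ) * ε := by
      simp only [mul_add, mul_sub, Finset.sum_add_distrib, Finset.sum_sub_distrib,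
        ← Finset.sum_mul, hν1, one_mul]
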